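/- arXiv:2311.16382 — 2 statements merged into one kernel-verified Lean document; each statement's English description precedes it below -/
import Mathlib

section
/- Let T be a trivial technology set, i.e., (x^min, y^max) ∈ T, and let a GS path-based model on T use, for some θ_min ∈ [0,1) ∩ D, the GS range directions. Then every unit (x_o,y_o) ∈ T with (x_o,y_o) ≠ (x^min, y^max) has efficiency score θ*_o = θ_min; in particular, all such units have the same score and strict monotonicity fails whenever T contains two distinct comparable units other than the ideal point. -/
open Finset

noncomputable section

variable {m s n : ℕ}

/-- The VRS technology set generated by data matrices `X`, `Y`. -/
def Tset (X : Matrix (Fin m) (Fin n) ℝ) (Y : Matrix (Fin s) (Fin n) ℝ) :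
    Set ((Fin m → ℝ) × (Fin s → ℝ)) :=
  {p | ∃ lam : Fin n → ℝ, (∀ j, 0 ≤ lam j) ∧ (∑ j, lam j) = 1 ∧
    Matrix.mulVec X lam ≤ p.1 ∧ p.2 ≤ Matrix.mulVec Y lam}

/-- `p` weakly dominates `q`. -/
def WeakDom (p q : (Fin m → ℝ) × (Fin s → ℝ)) : Prop :=
  p.1 ≤ q.1 ∧ q.2 ≤ p.2

/-- `p` dominates `q`. -/
def Dom (p q : (Fin m → ℝ) × (Fin s → ℝ)) : Prop :=
  WeakDom p q ∧ p ≠ q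

/-- A unit is strongly efficient if it lies in `T` and no point of `T` dominates it. -/
def StrongEff (X : Matrix (Fin m) (Fin n) ℝ) (Y : Matrix (Fin s) (Fin n) ℝ)
    (p : (Fin m → ℝ) × (Fin s → ℝ)) : Prop :=
  p ∈ Tset X Y ∧ ∀ q ∈ Tset X Y, ¬ Dom q p

/-- The strongly efficient frontier `∂^S T`. -/
def strongFrontier (X : Matrix (Fin m) (Fin n) ℝ) (Y : Matrix (Fin s) (Fin n) ℝ) :
    Set ((Fin m → ℝ) × (Fin s → ℝ)) :=
  {p | StrongEff X Y p}

/-- The weakly (but not strongly) efficient frontier `∂^W T = ∂T \ ∂^S T`. -/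
def weakFrontier (X : Matrix (Fin m) (Fin n) ℝ) (Y : Matrix (Fin s) (Fin n) ℝ) :
    Set ((Fin m → ℝ) × (Fin s → ℝ)) :=
  frontier (Tset X Y) \ strongFrontier X Y

/-- Componentwise minimum of the input data. -/
def xmin (X : Matrix (Fin m) (Fin n) ℝ) : Fin m → ℝ := fun i => ⨅ j, X i j

/-- Componentwise maximum of the output data. -/
def ymax (Y : Matrix (Fin s) (Fin n) ℝ) : Fin s → ℝ := fun r => ⨆ j, Y r j

/-- The ideal point `(x^min, y^max)`. -/
def idealPoint (X : Matrix (Fin m) (Fin n) ℝ) (Y : Matrix (Fin s) (Fin n) ℝ) :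
    (Fin m → ℝ) × (Fin s → ℝ) :=
  (xmin X, ymax Y)

/-- `T` is an ideal technology: every weakly-but-not-strongly efficient point shares at
least one coordinate with the ideal point. -/
def IdealTech (X : Matrix (Fin m) (Fin n) ℝ) (Y : Matrix (Fin s) (Fin n) ℝ) : Prop :=
  ∀ p ∈ weakFrontier X Y, (∃ i, p.1 i = xmin X i) ∨ (∃ r, p.2 r = ymax Y r)

/-- The pair of path-generating functions `ψ^x, ψ^y` of a GS path-based model, together
with their domains and the standing assumptions (A1)–(A4). -/
structure GSPsi where
  ψx : ℝ → ℝ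
  ψy : ℝ → ℝ
  Dx : Set ℝ
  Dy : Set ℝ
  hDx : Dx = Set.univ ∨ Dx = Set.Ioi (0 : ℝ)
  hDy : Dy = Set.univ ∨ Dy = Set.Ioi (0 : ℝ)
  hψx_diff : DifferentiableOn ℝ ψx Dx
  hψy_diff : DifferentiableOn ℝ ψy Dy
  hψx_conc : ConcaveOn ℝ Dx ψx
  hψy_conv : ConvexOn ℝ Dy ψy
  hψx_mono : StrictMonoOn ψx Dx
  hψy_anti : StrictAntiOn ψy Dy
  hone_x : (1 : ℝ) ∈ Dx
  hone_y : (1 : ℝ) ∈ Dy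
  hψx_one : ψx 1 = 1
  hψy_one : ψy 1 = 1
  himx : ψx '' Dx = Set.univ ∨ ψx '' Dx = Set.Ioi (0 : ℝ)
  himy : ψy '' Dy = Set.univ ∨ ψy '' Dy = Set.Ioi (0 : ℝ)

/-- The common domain `D = dom ψ^x ∩ dom ψ^y`. -/
def GSPsi.D (P : GSPsi) : Set ℝ := P.Dx ∩ P.Dy

/-- The GS range direction with parameter `θ_min` for the unit `p`. -/
def rangeDir (P : GSPsi) (X : Matrix (Fin m) (Fin n) ℝ) (Y : Matrix (Fin s) (Fin n) ℝ)
    (θmin : ℝ) (p : (Fin m → ℝ) × (Fin s → ℝ)) : (Fin m → ℝ) × (Fin s → ℝ) :=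
  ((1 - P.ψx θmin)⁻¹ • (p.1 - xmin X), (P.ψy θmin - 1)⁻¹ • (ymax Y - p.2))

/-- Input component of the path with GS range directions. -/
def pathRx (P : GSPsi) (X : Matrix (Fin m) (Fin n) ℝ) (Y : Matrix (Fin s) (Fin n) ℝ)
    (θmin : ℝ) (p : (Fin m → ℝ) × (Fin s → ℝ)) (θ : ℝ) : Fin m → ℝ :=
  p.1 + (P.ψx θ - 1) • (rangeDir P X Y θmin p).1

/-- Output component of the path with GS range directions. -/
def pathRy (P : GSPsi) (X : Matrix (Fin m) (Fin n) ℝ) (Y : Matrix (Fin s) (Fin n) ℝ)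
    (θmin : ℝ) (p : (Fin m → ℝ) × (Fin s → ℝ)) (θ : ℝ) : Fin s → ℝ :=
  p.2 + (P.ψy θ - 1) • (rangeDir P X Y θmin p).2

/-- The path with GS range directions. -/
def pathR (P : GSPsi) (X : Matrix (Fin m) (Fin n) ℝ) (Y : Matrix (Fin s) (Fin n) ℝ)
    (θmin : ℝ) (p : (Fin m → ℝ) × (Fin s → ℝ)) (θ : ℝ) :
    (Fin m → ℝ) × (Fin s → ℝ) :=
  (pathRx P X Y θmin p θ, pathRy P X Y θmin p θ)

/-- `θ` is feasible for `p` in the GS programme with GS range directions. -/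
def feasibleR (P : GSPsi) (X : Matrix (Fin m) (Fin n) ℝ) (Y : Matrix (Fin s) (Fin n) ℝ)
    (θmin : ℝ) (p : (Fin m → ℝ) × (Fin s → ℝ)) (θ : ℝ) : Prop :=
  θ ∈ P.D ∧ ∃ lam : Fin n → ℝ, (∀ j, 0 ≤ lam j) ∧ (∑ j, lam j) = 1 ∧
    Matrix.mulVec X lam ≤ pathRx P X Y θmin p θ ∧
    pathRy P X Y θmin p θ ≤ Matrix.mulVec Y lam

theorem xmin_le_mulVec (X : Matrix (Fin m) (Fin n) ℝ) {lam : Fin n → ℝ}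
    (h0 : ∀ j, 0 ≤ lam j) (h1 : (∑ j, lam j) = 1) : xmin X ≤ Matrix.mulVec X lam := by
  intro i
  calc xmin X i = ∑ j, xmin X i * lam j := by rw [← Finset.mul_sum, h1, mul_one]
    _ ≤ ∑ j, X i j * lam j := Finset.sum_le_sum fun j _ =>
        mul_le_mul_of_nonneg_right (ciInf_le (Set.finite_range _).bddBelow j) (h0 j)

theorem mulVec_le_ymax (Y : Matrix (Fin s) (Fin n) ℝ) {lam : Fin n → ℝ}
    (h0 : ∀ j, 0 ≤ lam j) (h1 : (∑ j, lam j) = 1) : Matrix.mulVec Y lam ≤ ymax Y := by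
  intro r
  calc ∑ j, Y r j * lam j ≤ ∑ j, ymax Y r * lam j := Finset.sum_le_sum fun j _ =>
        mul_le_mul_of_nonneg_right (le_ciSup (Set.finite_range _).bddAbove j) (h0 j)
    _ = ymax Y r := by rw [← Finset.mul_sum, h1, mul_one]

theorem weakDom_idealPoint {X : Matrix (Fin m) (Fin n) ℝ} {Y : Matrix (Fin s) (Fin n) ℝ}
    {p : (Fin m → ℝ) × (Fin s → ℝ)} (hp : p ∈ Tset X Y) : WeakDom (idealPoint X Y) p := by
  obtain ⟨lam, h0, h1, hx, hy⟩ := hp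
  exact ⟨(xmin_le_mulVec X h0 h1).trans hx, hy.trans (mulVec_le_ymax Y h0 h1)⟩

theorem GSPsi.ψx_lt_one (P : GSPsi) {θ : ℝ} (hD : θ ∈ P.D) (h : θ < 1) : P.ψx θ < 1 :=
  (P.hψx_mono hD.1 P.hone_x h).trans_eq P.hψx_one

theorem GSPsi.one_lt_ψy (P : GSPsi) {θ : ℝ} (hD : θ ∈ P.D) (h : θ < 1) : 1 < P.ψy θ :=
  P.hψy_one.symm.trans_lt (P.hψy_anti hD.2 P.hone_y h)

/-- At parameter `θ_min` the path reaches the ideal point. -/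
theorem pathR_θmin (P : GSPsi) (X : Matrix (Fin m) (Fin n) ℝ) (Y : Matrix (Fin s) (Fin n) ℝ)
    {θmin : ℝ} (hD : θmin ∈ P.D) (h : θmin < 1) (p : (Fin m → ℝ) × (Fin s → ℝ)) :
    pathR P X Y θmin p θmin = idealPoint X Y := by
  have hx : 1 - P.ψx θmin ≠ 0 := (sub_pos.2 (P.ψx_lt_one hD h)).ne'
  have hy : P.ψy θmin - 1 ≠ 0 := (sub_pos.2 (P.one_lt_ψy hD h)).ne'
  ext i
  · simp only [pathR, pathRx, rangeDir, idealPoint, Pi.add_apply, Pi.smul_apply, Pi.sub_apply,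
      smul_eq_mul]
    field_simp
    ring
  · simp only [pathR, pathRy, rangeDir, idealPoint, Pi.add_apply, Pi.smul_apply, Pi.sub_apply,
      smul_eq_mul]
    field_simp
    ring

theorem feasibleR_iff {P : GSPsi} {X : Matrix (Fin m) (Fin n) ℝ}
    {Y : Matrix (Fin s) (Fin n) ℝ} {θmin θ : ℝ} {p : (Fin m → ℝ) × (Fin s → ℝ)} :
    feasibleR P X Y θmin p θ ↔ θ ∈ P.D ∧ pathR P X Y θmin p θ ∈ Tset X Y :=
  Iff.rfl

/-- Below `θ_min` the path of a unit other than the ideal point has left the technology. -/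
theorem θmin_le_of_feasibleR {P : GSPsi} {X : Matrix (Fin m) (Fin n) ℝ}
    {Y : Matrix (Fin s) (Fin n) ℝ} {θmin θ : ℝ} {p : (Fin m → ℝ) × (Fin s → ℝ)}
    (hD : θmin ∈ P.D) (h : θmin < 1) (hp : p ∈ Tset X Y) (hne : p ≠ idealPoint X Y)
    (hf : feasibleR P X Y θmin p θ) : θmin ≤ θ := by
  by_contra! hlt
  obtain ⟨hθ, hT⟩ := feasibleR_iff.1 hf
  have hpath := weakDom_idealPoint hT
  have hmin := pathR_θmin P X Y hD h p
  have hideal := weakDom_idealPoint hp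
  refine hne (Prod.ext (funext fun i => ?_) (funext fun r => ?_))
  · refine le_antisymm ?_ (hideal.1 i)
    by_contra! hi
    have hdir : 0 < (rangeDir P X Y θmin p).1 i :=
      mul_pos (inv_pos.2 (sub_pos.2 (P.ψx_lt_one hD h))) (sub_pos.2 hi)
    have h1 : xmin X i ≤ p.1 i + (P.ψx θ - 1) * (rangeDir P X Y θmin p).1 i := hpath.1 i
    have h2 : p.1 i + (P.ψx θmin - 1) * (rangeDir P X Y θmin p).1 i = xmin X i :=
      congrFun (congrArg Prod.fst hmin) i
    have h3 := mul_lt_mul_of_pos_right (P.hψx_mono hθ.1 hD.1 hlt) hdir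
    linarith
  · refine le_antisymm (hideal.2 r) ?_
    by_contra! hr
    have hdir : 0 < (rangeDir P X Y θmin p).2 r :=
      mul_pos (inv_pos.2 (sub_pos.2 (P.one_lt_ψy hD h))) (sub_pos.2 hr)
    have h1 : p.2 r + (P.ψy θ - 1) * (rangeDir P X Y θmin p).2 r ≤ ymax Y r := hpath.2 r
    have h2 : p.2 r + (P.ψy θmin - 1) * (rangeDir P X Y θmin p).2 r = ymax Y r :=
      congrFun (congrArg Prod.snd hmin) r
    have h3 := mul_lt_mul_of_pos_right (P.hψy_anti hθ.2 hD.2 hlt) hdir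
    linarith

theorem isLeast_feasibleR_θmin {P : GSPsi} {X : Matrix (Fin m) (Fin n) ℝ}
    {Y : Matrix (Fin s) (Fin n) ℝ} {θmin : ℝ} {p : (Fin m → ℝ) × (Fin s → ℝ)}
    (htriv : idealPoint X Y ∈ Tset X Y) (hD : θmin ∈ P.D) (h : θmin < 1)
    (hp : p ∈ Tset X Y) (hne : p ≠ idealPoint X Y) :
    IsLeast {θ | feasibleR P X Y θmin p θ} θmin :=
  ⟨feasibleR_iff.2 ⟨hD, (pathR_θmin P X Y hD h p).symm ▸ htriv⟩,
    fun _ hf => θmin_le_of_feasibleR hD h hp hne hf⟩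

/-- over a trivial technology (containing its ideal point), the GS model
with GS range directions gives every unit other than the ideal point the score
`θ_min`; in particular strict monotonicity fails for any pair of distinct comparable
units other than the ideal point. -/
theorem stmt10 (hn : 0 < n) (X : Matrix (Fin m) (Fin n) ℝ) (Y : Matrix (Fin s) (Fin n) ℝ)
    (htriv : idealPoint X Y ∈ Tset X Y)
    (P : GSPsi) (θmin : ℝ) (hθ : θmin ∈ Set.Ico (0 : ℝ) 1 ∩ P.D)
    (score : ((Fin m → ℝ) × (Fin s → ℝ)) → ℝ)
    (hscore : ∀ p ∈ Tset X Y, p ≠ idealPoint X Y →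
      IsLeast {θ | feasibleR P X Y θmin p θ} (score p)) :
    (∀ p ∈ Tset X Y, p ≠ idealPoint X Y → score p = θmin) ∧
      (∀ p ∈ Tset X Y, p ≠ idealPoint X Y → ∀ q ∈ Tset X Y, q ≠ idealPoint X Y →
        Dom p q → ¬ score q < score p) := by
  have hs : ∀ p ∈ Tset X Y, p ≠ idealPoint X Y → score p = θmin := fun p hp hne =>
    (hscore p hp hne).unique (isLeast_feasibleR_θmin htriv hθ.2 hθ.1.2 hp hne)
  refine ⟨hs, fun p hp hpne q hq hqne _ => ?_⟩
  rw [hs p hp hpne, hs q hq hqne]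
  exact lt_irrefl _

end
end

section
/- The VRS technology set T is an ideal technology if and only if the weakly efficient frontier satisfies ∂^W T = ((⋃_{i=1}^m F^x_i) ∪ (⋃_{r=1}^s F^y_r)) \ ∂^S T, where F^x_i = {(x,y) ∈ T : x_i = x^min_i} and F^y_r = {(x,y) ∈ T : y_r = y^max_r}. -/
open Finset

noncomputable section

variable {m s n : ℕ}

theorem isClosed_Tset (X : Matrix (Fin m) (Fin n) ℝ) (Y : Matrix (Fin s) (Fin n) ℝ) :
    IsClosed (Tset X Y) := by
  have hclosed : IsClosed {z : stdSimplex ℝ (Fin n) × ((Fin m → ℝ) × (Fin s → ℝ)) |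
      Matrix.mulVec X z.1.1 ≤ z.2.1 ∧ z.2.2 ≤ Matrix.mulVec Y z.1.1} := by
    have hcont : Continuous fun z : stdSimplex ℝ (Fin n) × ((Fin m → ℝ) × (Fin s → ℝ)) =>
        z.1.1 := continuous_subtype_val.comp continuous_fst
    exact (isClosed_le (continuous_const.matrix_mulVec hcont) (by fun_prop)).inter
      (isClosed_le (by fun_prop) (continuous_const.matrix_mulVec hcont))
  convert isClosedMap_snd_of_compactSpace _ hclosed using 1
  ext p
  constructor
  · rintro ⟨lam, h0, h1, hx, hy⟩
    exact ⟨(⟨lam, h0, h1⟩, p), ⟨hx, hy⟩, rfl⟩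
  · rintro ⟨⟨lam, q⟩, ⟨hx, hy⟩, rfl⟩
    exact ⟨lam.1, lam.2.1, lam.2.2, hx, hy⟩

theorem xmin_le_of_mem_Tset {X : Matrix (Fin m) (Fin n) ℝ} {Y : Matrix (Fin s) (Fin n) ℝ}
    {p : (Fin m → ℝ) × (Fin s → ℝ)} (hp : p ∈ Tset X Y) (i : Fin m) : xmin X i ≤ p.1 i := by
  obtain ⟨lam, h0, h1, hx, -⟩ := hp
  refine le_trans ?_ (hx i)
  calc xmin X i = ∑ j, xmin X i * lam j := by rw [← Finset.mul_sum, h1, mul_one]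
    _ ≤ ∑ j, X i j * lam j := Finset.sum_le_sum fun j _ =>
        mul_le_mul_of_nonneg_right (ciInf_le (Set.finite_range _).bddBelow j) (h0 j)

theorem le_ymax_of_mem_Tset {X : Matrix (Fin m) (Fin n) ℝ} {Y : Matrix (Fin s) (Fin n) ℝ}
    {p : (Fin m → ℝ) × (Fin s → ℝ)} (hp : p ∈ Tset X Y) (r : Fin s) : p.2 r ≤ ymax Y r := by
  obtain ⟨lam, h0, h1, -, hy⟩ := hp
  refine le_trans (hy r) ?_
  calc ∑ j, Y r j * lam j ≤ ∑ j, ymax Y r * lam j := Finset.sum_le_sum fun j _ =>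
        mul_le_mul_of_nonneg_right (le_ciSup (Set.finite_range _).bddAbove j) (h0 j)
    _ = ymax Y r := by rw [← Finset.mul_sum, h1, mul_one]

theorem mem_frontier_of_eq_xmin {X : Matrix (Fin m) (Fin n) ℝ} {Y : Matrix (Fin s) (Fin n) ℝ}
    {p : (Fin m → ℝ) × (Fin s → ℝ)} (hp : p ∈ Tset X Y) {i : Fin m} (hi : p.1 i = xmin X i) :
    p ∈ frontier (Tset X Y) := by
  refine ⟨subset_closure hp, fun hint => ?_⟩
  have hopen : IsOpenMap fun q : (Fin m → ℝ) × (Fin s → ℝ) => q.1 i :=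
    (isOpenMap_eval i).comp isOpenMap_fst
  have hsub : Tset X Y ⊆ (fun q : (Fin m → ℝ) × (Fin s → ℝ) => q.1 i) ⁻¹' Set.Ici (xmin X i) :=
    fun _ hq => xmin_le_of_mem_Tset hq i
  have hlt := interior_mono hsub hint
  rw [← hopen.preimage_interior_eq_interior_preimage (by fun_prop), interior_Ici] at hlt
  exact (Set.mem_Ioi.1 hlt).ne' hi

theorem mem_frontier_of_eq_ymax {X : Matrix (Fin m) (Fin n) ℝ} {Y : Matrix (Fin s) (Fin n) ℝ}
    {p : (Fin m → ℝ) × (Fin s → ℝ)} (hp : p ∈ Tset X Y) {r : Fin s} (hr : p.2 r = ymax Y r) :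
    p ∈ frontier (Tset X Y) := by
  refine ⟨subset_closure hp, fun hint => ?_⟩
  have hopen : IsOpenMap fun q : (Fin m → ℝ) × (Fin s → ℝ) => q.2 r :=
    (isOpenMap_eval r).comp isOpenMap_snd
  have hsub : Tset X Y ⊆ (fun q : (Fin m → ℝ) × (Fin s → ℝ) => q.2 r) ⁻¹' Set.Iic (ymax Y r) :=
    fun _ hq => le_ymax_of_mem_Tset hq r
  have hlt := interior_mono hsub hint
  rw [← hopen.preimage_interior_eq_interior_preimage (by fun_prop), interior_Iic] at hlt
  exact (Set.mem_Iio.1 hlt).ne hr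

/-- `T` is an ideal technology iff the weakly efficient frontier equals
the union of the special facets minus the strongly efficient frontier. -/
theorem stmt13 (hn : 0 < n) (X : Matrix (Fin m) (Fin n) ℝ)
    (Y : Matrix (Fin s) (Fin n) ℝ) :
    IdealTech X Y ↔
      weakFrontier X Y =
        ((⋃ i : Fin m, {p ∈ Tset X Y | p.1 i = xmin X i}) ∪
          (⋃ r : Fin s, {p ∈ Tset X Y | p.2 r = ymax Y r})) \ strongFrontier X Y := by
  constructor
  · intro h
    ext p
    constructor
    · intro hp
      have hT : p ∈ Tset X Y := (isClosed_Tset X Y).frontier_subset hp.1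
      refine ⟨?_, hp.2⟩
      rcases h p hp with ⟨i, hi⟩ | ⟨r, hr⟩
      · exact Or.inl (Set.mem_iUnion.2 ⟨i, hT, hi⟩)
      · exact Or.inr (Set.mem_iUnion.2 ⟨r, hT, hr⟩)
    · rintro ⟨hp | hp, hS⟩
      · obtain ⟨i, hT, hi⟩ := Set.mem_iUnion.1 hp
        exact ⟨mem_frontier_of_eq_xmin hT hi, hS⟩
      · obtain ⟨r, hT, hr⟩ := Set.mem_iUnion.1 hp
        exact ⟨mem_frontier_of_eq_ymax hT hr, hS⟩
  · intro h p hp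
    rw [h] at hp
    rcases hp.1 with hp | hp
    · obtain ⟨i, -, hi⟩ := Set.mem_iUnion.1 hp
      exact Or.inl ⟨i, hi⟩
    · obtain ⟨r, -, hr⟩ := Set.mem_iUnion.1 hp
      exact Or.inr ⟨r, hr⟩

end
end
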